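/- arXiv:1404.6042 — 5 statements merged into one kernel-verified Lean document; each statement's English description precedes it below -/
import Mathlib

section
/- Let a and b be non-lightlike vectors in the Lorentzian plane with the same causal character and with a/‖a‖_L ≠ b/‖b‖_L. If w₁ and w₂ are both nonzero angle bisectors of a and b, then w₁ and w₂ are scalar multiples of each other, i.e., there exists a nonzero real t with w₁ = t • w₂. -/
noncomputable section

/-- The Lorentzian inner product on ℝ²: `⟪(a₁,a₂),(b₁,b₂)⟫_L = a₁b₁ − a₂b₂`. -/
def lprod (v w : ℝ × ℝ) : ℝ := v.1 * w.1 - v.2 * w.2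

/-- The Lorentzian magnitude `‖v‖_L = √|⟪v,v⟫_L|`. -/
def lmag (v : ℝ × ℝ) : ℝ := Real.sqrt |lprod v v|

/-- `w` is an angle bisector of `a` and `b` if
`⟪a,w⟫_L/√|⟪a,a⟫_L| = ⟪b,w⟫_L/√|⟪b,b⟫_L|`. -/
def IsAngleBisector (a b w : ℝ × ℝ) : Prop :=
  lprod a w / Real.sqrt |lprod a a| = lprod b w / Real.sqrt |lprod b b|

/-- `a` and `b` are non-lightlike of the same causal character:
both spacelike or both timelike. -/
def SameCausal (a b : ℝ × ℝ) : Prop :=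
  (0 < lprod a a ∧ 0 < lprod b b) ∨ (lprod a a < 0 ∧ lprod b b < 0)

/-- `a` and `b` are non-lightlike of the same causal character and orientation:
in the spacelike case the first coordinates have the same sign, in the timelike
case the second coordinates have the same sign. -/
def SameCausalOrient (a b : ℝ × ℝ) : Prop :=
  (0 < lprod a a ∧ 0 < lprod b b ∧ ((0 < a.1 ∧ 0 < b.1) ∨ (a.1 < 0 ∧ b.1 < 0))) ∨
  (lprod a a < 0 ∧ lprod b b < 0 ∧ ((0 < a.2 ∧ 0 < b.2) ∨ (a.2 < 0 ∧ b.2 < 0)))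

/-- The line through points `X` and `Y`: `{X + t(Y−X) : t ∈ ℝ}`. -/
def lineThrough (X Y : ℝ × ℝ) : Set (ℝ × ℝ) := {P | ∃ t : ℝ, P = X + t • (Y - X)}

theorem lprod_sub_left (u v w : ℝ × ℝ) : lprod (u - v) w = lprod u w - lprod v w := by
  simp only [lprod, Prod.fst_sub, Prod.snd_sub]
  ring

theorem lprod_smul_left (c : ℝ) (v w : ℝ × ℝ) : lprod (c • v) w = c * lprod v w := by
  simp only [lprod, Prod.smul_fst, Prod.smul_snd, smul_eq_mul]
  ring

/-- A nonzero vector Lorentz-orthogonal to `u ≠ 0` is a nonzero multiple of `u.swap`. -/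
theorem exists_eq_smul_swap_of_lprod_eq_zero {u w : ℝ × ℝ} (hu : u ≠ 0) (hw : w ≠ 0)
    (h : lprod u w = 0) : ∃ s : ℝ, s ≠ 0 ∧ w = s • u.swap := by
  obtain ⟨s, hs⟩ : ∃ s : ℝ, w = s • u.swap := by
    rw [lprod, sub_eq_zero] at h
    by_cases h1 : u.1 = 0
    · have h2 : u.2 ≠ 0 := fun h2 => hu (Prod.ext h1 h2)
      refine ⟨w.1 / u.2, Prod.ext ?_ ?_⟩ <;> simp <;> field_simp
      linarith
    · refine ⟨w.2 / u.1, Prod.ext ?_ ?_⟩ <;> simp <;> field_simp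
      linarith
  exact ⟨s, fun h0 => hw (by rw [hs, h0, zero_smul]), hs⟩

theorem IsAngleBisector.lprod_eq_zero {a b w : ℝ × ℝ} (h : IsAngleBisector a b w) :
    lprod ((lmag a)⁻¹ • a - (lmag b)⁻¹ • b) w = 0 := by
  rw [lprod_sub_left, lprod_smul_left, lprod_smul_left, sub_eq_zero, inv_mul_eq_div,
    inv_mul_eq_div]
  exact h

/-- two nonzero angle bisectors of a pair of non-lightlike vectors
with the same causal character (and non-proportional unit vectors) are scalar
multiples of each other. -/
theorem angleBisector_unique_up_to_scalar (a b w₁ w₂ : ℝ × ℝ)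
    (hcc : SameCausal a b)
    (hne : (lmag a)⁻¹ • a ≠ (lmag b)⁻¹ • b)
    (hw₁ : w₁ ≠ 0) (hw₂ : w₂ ≠ 0)
    (h₁ : IsAngleBisector a b w₁) (h₂ : IsAngleBisector a b w₂) :
    ∃ t : ℝ, t ≠ 0 ∧ w₁ = t • w₂ := by
  obtain ⟨s, hs, rfl⟩ :=
    exists_eq_smul_swap_of_lprod_eq_zero (sub_ne_zero.mpr hne) hw₁ h₁.lprod_eq_zero
  obtain ⟨r, hr, rfl⟩ :=
    exists_eq_smul_swap_of_lprod_eq_zero (sub_ne_zero.mpr hne) hw₂ h₂.lprod_eq_zero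
  exact ⟨s / r, div_ne_zero hs hr, by rw [smul_smul, div_mul_cancel₀ s hr]⟩
end
end

section
/- Let a and b be non-lightlike vectors in the Lorentzian plane with the same causal character and the same orientation. Then the vector a/‖a‖_L + b/‖b‖_L is not lightlike; in fact ⟪a/‖a‖_L + b/‖b‖_L, a/‖a‖_L + b/‖b‖_L⟫_L has the same sign as ⟪a,a⟫_L. -/
noncomputable section

theorem mul_lt_mul_of_sq_lt_sq {x y z w : ℝ} (hxy : y ^ 2 < x ^ 2) (hzw : w ^ 2 < z ^ 2)
    (hxz : 0 < x * z) : y * w < x * z :=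
  calc y * w ≤ |y * w| := le_abs_self _
    _ = |y| * |w| := abs_mul y w
    _ < |x| * |z| :=
      mul_lt_mul'' (sq_lt_sq.mp hxy) (sq_lt_sq.mp hzw) (abs_nonneg _) (abs_nonneg _)
    _ = x * z := by rw [← abs_mul, abs_of_pos hxz]

theorem SameCausalOrient.lprod_pos_or_neg {a b : ℝ × ℝ} (hab : SameCausalOrient a b) :
    (0 < lprod a a ∧ 0 < lprod b b ∧ 0 < lprod a b) ∨
      (lprod a a < 0 ∧ lprod b b < 0 ∧ lprod a b < 0) := by
  rcases hab with ⟨ha, hb, h⟩ | ⟨ha, hb, h⟩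
  · refine Or.inl ⟨ha, hb, ?_⟩
    simp only [lprod] at ha hb ⊢
    linarith [mul_lt_mul_of_sq_lt_sq (by linarith : a.2 ^ 2 < a.1 ^ 2)
      (by linarith : b.2 ^ 2 < b.1 ^ 2) (mul_pos_iff.mpr h)]
  · refine Or.inr ⟨ha, hb, ?_⟩
    simp only [lprod] at ha hb ⊢
    linarith [mul_lt_mul_of_sq_lt_sq (by linarith : a.1 ^ 2 < a.2 ^ 2)
      (by linarith : b.1 ^ 2 < b.2 ^ 2) (mul_pos_iff.mpr h)]

theorem lmag_pos {a : ℝ × ℝ} (ha : lprod a a ≠ 0) : 0 < lmag a :=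
  Real.sqrt_pos.mpr (abs_pos.mpr ha)

theorem lprod_smul_add_smul_self (p q : ℝ) (a b : ℝ × ℝ) :
    lprod (p • a + q • b) (p • a + q • b) =
      p ^ 2 * lprod a a + 2 * (p * q) * lprod a b + q ^ 2 * lprod b b := by
  simp only [lprod, Prod.fst_add, Prod.snd_add, Prod.smul_fst, Prod.smul_snd, smul_eq_mul]
  ring

/-- for non-lightlike vectors `a`, `b` of the same causal character
and orientation, `a/‖a‖_L + b/‖b‖_L` is not lightlike; indeed
`⟪a/‖a‖_L + b/‖b‖_L, a/‖a‖_L + b/‖b‖_L⟫_L` has the same sign as `⟪a,a⟫_L`. -/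
theorem sum_of_unit_vectors_not_lightlike (a b : ℝ × ℝ)
    (hab : SameCausalOrient a b) :
    lprod ((lmag a)⁻¹ • a + (lmag b)⁻¹ • b) ((lmag a)⁻¹ • a + (lmag b)⁻¹ • b) ≠ 0 ∧
    (0 < lprod ((lmag a)⁻¹ • a + (lmag b)⁻¹ • b) ((lmag a)⁻¹ • a + (lmag b)⁻¹ • b) ↔
      0 < lprod a a) := by
  rw [lprod_smul_add_smul_self]
  rcases hab.lprod_pos_or_neg with ⟨ha, hb, h⟩ | ⟨ha, hb, h⟩
  · have hp := inv_pos.mpr (lmag_pos ha.ne')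
    have hq := inv_pos.mpr (lmag_pos hb.ne')
    have hs : 0 < (lmag a)⁻¹ ^ 2 * lprod a a + 2 * ((lmag a)⁻¹ * (lmag b)⁻¹) * lprod a b +
        (lmag b)⁻¹ ^ 2 * lprod b b := by positivity
    exact ⟨hs.ne', iff_of_true hs ha⟩
  · have hp := inv_pos.mpr (lmag_pos ha.ne)
    have hq := inv_pos.mpr (lmag_pos hb.ne)
    have hs : (lmag a)⁻¹ ^ 2 * lprod a a + 2 * ((lmag a)⁻¹ * (lmag b)⁻¹) * lprod a b +
        (lmag b)⁻¹ ^ 2 * lprod b b < 0 :=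
      add_neg (add_neg (mul_neg_of_pos_of_neg (by positivity) ha)
        (mul_neg_of_pos_of_neg (by positivity) h)) (mul_neg_of_pos_of_neg (by positivity) hb)
    exact ⟨hs.ne, iff_of_false hs.not_gt ha.not_gt⟩
end
end

section
/- (Lorentzian law of sines) Let a, b, c be vectors in the Lorentzian plane with a + b + c = 0 and with none of them lightlike. Then S²(b,c)/⟪a,a⟫_L = S²(c,a)/⟪b,b⟫_L = S²(a,b)/⟪c,c⟫_L. -/
noncomputable section

/-- The squared Lorentzian sine `S²(u,v) = 1 − ⟪u,v⟫_L² / (⟪u,u⟫_L · ⟪v,v⟫_L)`. -/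
def S2 (u v : ℝ × ℝ) : ℝ := 1 - (lprod u v) ^ 2 / (lprod u u * lprod v v)

/-- The squared Lorentzian sine in terms of the determinant of the two vectors. -/
theorem S2_eq_neg_sq_det_div {u v : ℝ × ℝ} (hu : lprod u u ≠ 0) (hv : lprod v v ≠ 0) :
    S2 u v = -(u.1 * v.2 - u.2 * v.1) ^ 2 / (lprod u u * lprod v v) := by
  rw [S2, one_sub_div (mul_ne_zero hu hv)]
  congr 1
  simp only [lprod]
  ring

/-- Lorentzian law of sines: if `a + b + c = 0` and none of
`a`, `b`, `c` is lightlike, then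
`S²(b,c)/⟪a,a⟫_L = S²(c,a)/⟪b,b⟫_L = S²(a,b)/⟪c,c⟫_L`. -/
theorem lorentzian_law_of_sines (a b c : ℝ × ℝ)
    (hsum : a + b + c = 0)
    (ha : lprod a a ≠ 0) (hb : lprod b b ≠ 0) (hc : lprod c c ≠ 0) :
    S2 b c / lprod a a = S2 c a / lprod b b ∧
    S2 c a / lprod b b = S2 a b / lprod c c := by
  rw [S2_eq_neg_sq_det_div hb hc, S2_eq_neg_sq_det_div hc ha, S2_eq_neg_sq_det_div ha hb]
  have h : c = -(a + b) := (neg_eq_of_add_eq_zero_right hsum).symm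
  have hbc : b.1 * c.2 - b.2 * c.1 = a.1 * b.2 - a.2 * b.1 := by
    simp only [h, Prod.fst_neg, Prod.snd_neg, Prod.fst_add, Prod.snd_add]; ring
  have hca : c.1 * a.2 - c.2 * a.1 = a.1 * b.2 - a.2 * b.1 := by
    simp only [h, Prod.fst_neg, Prod.snd_neg, Prod.fst_add, Prod.snd_add]; ring
  rw [hbc, hca]
  constructor <;> field_simp
end
end

section
/- (Lorentzian Ceva's theorem) Let A, B, C be affinely independent points in the Lorentzian plane such that none of the side vectors C−B, A−C, B−A is lightlike, and let P be a point. Suppose D lies on both the line through B,C and the line through A,P with D ∉ {B,C}; E lies on both the line through C,A and the line through B,P with E ∉ {C,A}; and F lies on both the line through A,B and the line through C,P with F ∉ {A,B}. Then (⟪F−A,F−A⟫_L/⟪B−F,B−F⟫_L) · (⟪D−B,D−B⟫_L/⟪C−D,C−D⟫_L) · (⟪E−C,E−C⟫_L/⟪A−E,A−E⟫_L) = 1. -/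
noncomputable section

/-- The signed area (determinant) form on `ℝ × ℝ`. -/
def cross (v w : ℝ × ℝ) : ℝ := v.1 * w.2 - v.2 * w.1

lemma lprod_smul_smul (t : ℝ) (v : ℝ × ℝ) : lprod (t • v) (t • v) = t ^ 2 * lprod v v := by
  simp only [lprod, Prod.smul_fst, Prod.smul_snd, smul_eq_mul]
  ring

/-- The vertices of a nondegenerate triangle span a nonzero signed area. -/
lemma cross_ne_zero_of_affineIndependent {A B C : ℝ × ℝ}
    (hABC : AffineIndependent ℝ ![A, B, C]) (hc : lprod (B - A) (B - A) ≠ 0) :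
    cross (B - A) (C - A) ≠ 0 := by
  intro h
  refine affineIndependent_iff_not_collinear_set.mp hABC ?_
  rw [collinear_iff_of_mem (p₀ := A) (by simp)]
  refine ⟨B - A, ?_⟩
  simp only [Set.mem_insert_iff, Set.mem_singleton_iff, forall_eq_or_imp, forall_eq]
  refine ⟨⟨0, by simp⟩, ⟨1, by simp⟩,
    ⟨lprod (C - A) (B - A) / lprod (B - A) (B - A), ?_⟩⟩
  have key : lprod (B - A) (B - A) • (C - A) = lprod (C - A) (B - A) • (B - A) := by
    simp only [cross, lprod, Prod.fst_sub, Prod.snd_sub] at h ⊢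
    ext <;> simp only [Prod.smul_fst, Prod.smul_snd, Prod.fst_sub, Prod.snd_sub, smul_eq_mul]
    · linear_combination (B.2 - A.2) * h
    · linear_combination (B.1 - A.1) * h
  rw [div_eq_inv_mul, mul_smul, ← key, inv_smul_smul₀ hc, vadd_eq_add, sub_add_cancel]

/-- A point dividing `X Y` and lying on the line through `Z` and `P` divides `X Y` in the ratio
of the signed areas of the triangles that `P` and `Z` form with `X` and `Y`. -/
lemma mul_cross_eq_of_mem_lineThrough {X Y Z P : ℝ × ℝ} {t : ℝ}
    (h : X + t • (Y - X) ∈ lineThrough Z P) :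
    t * cross (Y - P) (Z - P) = (1 - t) * cross (Z - P) (X - P) := by
  obtain ⟨s, hs⟩ := h
  have h₁ := congrArg Prod.fst hs
  have h₂ := congrArg Prod.snd hs
  simp only [cross, Prod.fst_add, Prod.snd_add, Prod.smul_fst, Prod.smul_snd, Prod.fst_sub,
    Prod.snd_sub, smul_eq_mul] at h₁ h₂ ⊢
  linear_combination (Z.2 - P.2) * h₁ - (Z.1 - P.1) * h₂

/-- The ratio of the Lorentzian squares of the parts into which a point divides a
non-lightlike segment. -/
lemma lprod_div_lprod_of_mem_line {X Y : ℝ × ℝ} (t : ℝ) (h : lprod (Y - X) (Y - X) ≠ 0) :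
    lprod (X + t • (Y - X) - X) (X + t • (Y - X) - X) /
      lprod (Y - (X + t • (Y - X))) (Y - (X + t • (Y - X))) = (t / (1 - t)) ^ 2 := by
  have h₂ : Y - (X + t • (Y - X)) = (1 - t) • (Y - X) := by module
  rw [add_sub_cancel_left, h₂, lprod_smul_smul, lprod_smul_smul, mul_div_mul_right _ _ h, div_pow]

/-- A point `X + t • (Y - X)` other than `X` and `Y` has parameter other than `0` and `1`. -/
lemma param_ne_zero_and_one_sub_ne_zero {X Y : ℝ × ℝ} {t : ℝ}
    (hX : X + t • (Y - X) ≠ X) (hY : X + t • (Y - X) ≠ Y) : t ≠ 0 ∧ 1 - t ≠ 0 := by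
  refine ⟨fun h => hX (by simp [h]), fun h => hY ?_⟩
  rw [← sub_eq_zero.mp h, one_smul, add_sub_cancel]

/-- Lorentzian Ceva's theorem. -/
theorem lorentzian_ceva (A B C P D E F : ℝ × ℝ)
    (hABC : AffineIndependent ℝ ![A, B, C])
    (ha : lprod (C - B) (C - B) ≠ 0)
    (hb : lprod (A - C) (A - C) ≠ 0)
    (hc : lprod (B - A) (B - A) ≠ 0)
    (hD : D ∈ lineThrough B C) (hD' : D ∈ lineThrough A P) (hDB : D ≠ B) (hDC : D ≠ C)
    (hE : E ∈ lineThrough C A) (hE' : E ∈ lineThrough B P) (hEC : E ≠ C) (hEA : E ≠ A)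
    (hF : F ∈ lineThrough A B) (hF' : F ∈ lineThrough C P) (hFA : F ≠ A) (hFB : F ≠ B) :
    (lprod (F - A) (F - A) / lprod (B - F) (B - F)) *
    (lprod (D - B) (D - B) / lprod (C - D) (C - D)) *
    (lprod (E - C) (E - C) / lprod (A - E) (A - E)) = 1 := by
  obtain ⟨d, rfl⟩ := hD
  obtain ⟨e, rfl⟩ := hE
  obtain ⟨f, rfl⟩ := hF
  obtain ⟨hd, hd₁⟩ := param_ne_zero_and_one_sub_ne_zero hDB hDC
  obtain ⟨he, he₁⟩ := param_ne_zero_and_one_sub_ne_zero hEC hEA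
  obtain ⟨hf, hf₁⟩ := param_ne_zero_and_one_sub_ne_zero hFA hFB
  have hd₂ := mul_cross_eq_of_mem_lineThrough hD'
  have he₂ := mul_cross_eq_of_mem_lineThrough hE'
  have hf₂ := mul_cross_eq_of_mem_lineThrough hF'
  have hsum : cross (B - P) (C - P) + cross (C - P) (A - P) + cross (A - P) (B - P) =
      cross (B - A) (C - A) := by
    simp only [cross, Prod.fst_sub, Prod.snd_sub]
    ring
  have hΔ := cross_ne_zero_of_affineIndependent hABC hc
  rw [← hsum] at hΔ
  generalize cross (B - P) (C - P) = x at *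
  generalize cross (C - P) (A - P) = y at *
  generalize cross (A - P) (B - P) = z at *
  have hxy : x = 0 ↔ y = 0 := by simpa [hf, hf₁] using congrArg (· = 0) hf₂
  have hyz : y = 0 ↔ z = 0 := by simpa [hd, hd₁] using congrArg (· = 0) hd₂
  have hx : x ≠ 0 := fun h => hΔ (by simp [h, hxy.mp h, hyz.mp (hxy.mp h)])
  have hy : y ≠ 0 := mt hxy.mpr hx
  have hz : z ≠ 0 := mt hyz.mpr hy
  rw [lprod_div_lprod_of_mem_line f hc, lprod_div_lprod_of_mem_line d ha,
    lprod_div_lprod_of_mem_line e hb, (div_eq_div_iff hf₁ hx).mpr (by rw [hf₂, mul_comm]),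
    (div_eq_div_iff hd₁ hy).mpr (by rw [hd₂, mul_comm]),
    (div_eq_div_iff he₁ hz).mpr (by rw [he₂, mul_comm])]
  field_simp
end
end

section
/- (Converse of Ceva's theorem) Let A, B, C be affinely independent points in the plane ℝ². Let t, u, v be real numbers, none equal to 0 or 1, and set D = B + t(C−B), E = C + u(A−C), F = A + v(B−A). If (t/(1−t)) · (u/(1−u)) · (v/(1−v)) = 1 and the lines through A,D and through B,E are not parallel, then the three lines through A,D, through B,E, and through C,F have a common point. -/
noncomputable section

/-- STATEMENT 8 (Converse of Ceva's theorem) in the plane ℝ². -/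
theorem ceva_converse (A B C : ℝ × ℝ) (t u v : ℝ)
    (hABC : AffineIndependent ℝ ![A, B, C])
    (ht0 : t ≠ 0) (ht1 : t ≠ 1) (hu0 : u ≠ 0) (hu1 : u ≠ 1) (hv0 : v ≠ 0) (hv1 : v ≠ 1)
    (hprod : (t / (1 - t)) * (u / (1 - u)) * (v / (1 - v)) = 1)
    (hnp : LinearIndependent ℝ ![(B + t • (C - B)) - A, (C + u • (A - C)) - B]) :
    ∃ Q : ℝ × ℝ,
      Q ∈ lineThrough A (B + t • (C - B)) ∧
      Q ∈ lineThrough B (C + u • (A - C)) ∧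
      Q ∈ lineThrough C (A + v • (B - A)) := by
  have ht : 1 - t ≠ 0 := sub_ne_zero.mpr ht1.symm
  have hu : 1 - u ≠ 0 := sub_ne_zero.mpr hu1.symm
  have hv : 1 - v ≠ 0 := sub_ne_zero.mpr hv1.symm
  have hmul : t * u * v = (1 - t) * (1 - u) * (1 - v) := by
    field_simp at hprod
    linarith
  have hS : 1 - u + u * t ≠ 0 := by
    intro hS
    have hdep : (1 : ℝ) • ((B + t • (C - B)) - A) + (1 - t) • ((C + u • (A - C)) - B) = 0 := by
      ext
      · simp only [Prod.fst_add, Prod.fst_sub, Prod.smul_fst, smul_eq_mul, Prod.fst_zero]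
        linear_combination (C.1 - A.1) * hS
      · simp only [Prod.snd_add, Prod.snd_sub, Prod.smul_snd, smul_eq_mul, Prod.snd_zero]
        linear_combination (C.2 - A.2) * hS
    exact one_ne_zero (LinearIndependent.pair_iff.mp hnp _ _ hdep).1
  refine ⟨A + ((1 - u) / (1 - u + u * t)) • ((B + t • (C - B)) - A), ⟨_, rfl⟩,
    ⟨t / (1 - u + u * t), ?_⟩, ⟨(u * t + (1 - t) * (1 - u)) / (1 - u + u * t), ?_⟩⟩
  · ext <;> simp <;> field_simp <;> ring
  · ext
    · simp
      field_simp
      linear_combination (A.1 - B.1) * hmul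
    · simp
      field_simp
      linear_combination (A.2 - B.2) * hmul
end
end
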